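/- Let (E, Σ) be a measurable space equipped with a σ-finite measure m, let K be a measurable transition kernel from (E, Σ) to (ℝ^d, B(ℝ^d)) such that K_x({0}) = 0 and K_x(|y| ∧ |y|²) < ∞ for m-a.e. x, and let b : E → ℝ^d and c : E → (symmetric positive semidefinite d×d matrices) be Σ-measurable. For x ∈ E define D_x := {v ∈ ℝ^d : v·y > −1 for K_x-a.e. y}, Ψ_x(v) := b(x)·v − (1/2) v·(c(x)v) − ∫ (v·y − log(1 + v·y)) K_x(dy), N_x := {v : K_x({y : v·y ≠ 0}) = 0, c(x)v = 0, v·b(x) = 0}, I_x := {v : K_x({y : v·y < 0}) = 0, c(x)v = 0, v·b(x) ≥ ∫ v·y K_x(dy)} ∖ N_x, and ψ(x) := sup_{v∈D_x} Ψ_x(v) ∈ [0, ∞]. Then ψ is measurable with respect to the m-completion of Σ. If moreover m({x : I_x ≠ ∅}) = 0, then ψ(x) < ∞ for m-a.e. x and there exists a Σ-measurable function g : E → ℝ^d such that ψ(x) = Ψ_x(g(x)) for m-a.e. x. -/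

import Mathlib

open MeasureTheory Filter Set Matrix
open scoped ENNReal

noncomputable section

variable {d : ℕ}

/-- The Euclidean norm of a vector in `ℝ^d`. -/
def eucNorm (x : Fin d → ℝ) : ℝ := Real.sqrt (x ⬝ᵥ x)

/-- The integrability assumption `∫ (|x| ∧ |x|²) K(dx) < ∞` on the Lévy measure `K`. -/
def LevyIntegrable (K : Measure (Fin d → ℝ)) : Prop :=
  ∫⁻ x, ENNReal.ofReal (min (eucNorm x) (eucNorm x ^ 2)) ∂K ≠ ⊤

/-- The set `D = {v ∈ ℝ^d : v·x > −1 for K-a.e. x}`. -/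
def Dset (K : Measure (Fin d → ℝ)) : Set (Fin d → ℝ) :=
  {v | ∀ᵐ x ∂K, -1 < v ⬝ᵥ x}

/-- The concave function
`Ψ(v) = b·v − (1/2) v·(cv) − ∫ (v·x − log(1 + v·x)) K(dx)`, with values in `[−∞, ∞)`
(on `D` the integrand is nonnegative `K`-a.e.). -/
def Psi (K : Measure (Fin d → ℝ)) (b : Fin d → ℝ) (c : Matrix (Fin d) (Fin d) ℝ)
    (v : Fin d → ℝ) : EReal :=
  ((v ⬝ᵥ b - (1 / 2) * (v ⬝ᵥ (c *ᵥ v)) : ℝ) : EReal)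
    - ((∫⁻ x, ENNReal.ofReal (v ⬝ᵥ x - Real.log (1 + v ⬝ᵥ x)) ∂K : ℝ≥0∞) : EReal)

/-- The null-investment subspace
`N = {v : K(v·x ≠ 0) = 0, cv = 0, v·b = 0}`. -/
def Nset (K : Measure (Fin d → ℝ)) (b : Fin d → ℝ) (c : Matrix (Fin d) (Fin d) ℝ) :
    Set (Fin d → ℝ) :=
  {v | K {x | v ⬝ᵥ x ≠ 0} = 0 ∧ c *ᵥ v = 0 ∧ v ⬝ᵥ b = 0}

/-- The set `I = {v : K(v·x < 0) = 0, cv = 0, v·b ≥ K(v·x)} ∖ N`. -/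
def Iset (K : Measure (Fin d → ℝ)) (b : Fin d → ℝ) (c : Matrix (Fin d) (Fin d) ℝ) :
    Set (Fin d → ℝ) :=
  {v | K {x | v ⬝ᵥ x < 0} = 0 ∧ c *ᵥ v = 0 ∧
      (∫⁻ x, ENNReal.ofReal (v ⬝ᵥ x) ∂K) ≤ ENNReal.ofReal (v ⬝ᵥ b)} \ Nset K b c

/-- `F(v, v⁰) = (v − v⁰)·(b − cv⁰) − ∫ (v − v⁰)·x · (v⁰·x)/(1 + v⁰·x) K(dx)`, as an
extended real number (the integral is split into its positive and negative parts). -/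
def Fval (K : Measure (Fin d → ℝ)) (b : Fin d → ℝ) (c : Matrix (Fin d) (Fin d) ℝ)
    (v v0 : Fin d → ℝ) : EReal :=
  (((v - v0) ⬝ᵥ (b - c *ᵥ v0) : ℝ) : EReal)
    - (((∫⁻ x, ENNReal.ofReal
            (max (((v - v0) ⬝ᵥ x) * ((v0 ⬝ᵥ x) / (1 + v0 ⬝ᵥ x))) 0) ∂K : ℝ≥0∞) : EReal)
      - ((∫⁻ x, ENNReal.ofReal
            (max (-(((v - v0) ⬝ᵥ x) * ((v0 ⬝ᵥ x) / (1 + v0 ⬝ᵥ x)))) 0) ∂K : ℝ≥0∞) : EReal))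

def hr (y : ℝ) : ℝ := y - Real.log (1 + y)

def clampN (n : ℕ) (y : ℝ) : ℝ := max y (-1 + 1 / ((n : ℝ) + 1))

def Hn (n : ℕ) (y : ℝ) : ℝ≥0∞ := ENNReal.ofReal (hr (clampN n y))

def Hb (y : ℝ) : ℝ≥0∞ := if -1 < y then ENNReal.ofReal (hr y) else ⊤

lemma clampN_gt (n : ℕ) (y : ℝ) : -1 < clampN n y := by
  have : (0 : ℝ) < 1 / ((n : ℝ) + 1) := by positivity
  exact lt_of_lt_of_le (by linarith) (le_max_right _ _)

lemma hr_nonneg {y : ℝ} (hy : -1 < y) : 0 ≤ hr y := by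
  have := Real.log_le_sub_one_of_pos (show (0 : ℝ) < 1 + y by linarith)
  unfold hr; linarith

lemma hr_anti {x y : ℝ} (hx : -1 < x) (hxy : x ≤ y) (hy : y ≤ 0) : hr y ≤ hr x := by
  have h1 : (0 : ℝ) < 1 + x := by linarith
  have h2 : (0 : ℝ) < 1 + y := by linarith
  have h3 := Real.log_le_sub_one_of_pos (show (0 : ℝ) < (1 + x) / (1 + y) by positivity)
  rw [Real.log_div h1.ne' h2.ne'] at h3
  have h4 : (1 + x) / (1 + y) - 1 ≤ x - y := by
    rw [div_sub_one h2.ne', div_le_iff₀ h2]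
    nlinarith
  unfold hr; linarith

lemma one_div_le_one_nat (n : ℕ) : 1 / ((n : ℝ) + 1) ≤ 1 := by
  rw [div_le_one (by positivity)]; linarith [(Nat.cast_nonneg n : (0 : ℝ) ≤ n)]

lemma hr_clamp_le {n : ℕ} {x y : ℝ} (hx : -1 < x) (h : x = y ∨ (y ≤ x ∧ x ≤ -1 + 1 / ((n : ℝ) + 1))) :
    hr (clampN n y) ≤ hr x := by
  rcases le_total (-1 + 1 / ((n : ℝ) + 1)) y with h1 | h1
  · rw [clampN, max_eq_left h1]
    rcases h with rfl | h
    · exact le_rfl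
    · rw [show x = y by linarith [h.1, h.2]]
  · rw [clampN, max_eq_right h1]
    apply hr_anti hx
    · rcases h with rfl | h
      · exact h1
      · exact h.2
    · linarith [one_div_le_one_nat n]

lemma Hn_mono (y : ℝ) : Monotone (fun n => Hn n y) := by
  intro n k hnk
  apply ENNReal.ofReal_le_ofReal
  apply hr_clamp_le (clampN_gt k y)
  rcases le_total (-1 + 1 / ((k : ℝ) + 1)) y with h1 | h1
  · left; rw [clampN, max_eq_left h1]
  · right
    rw [clampN, max_eq_right h1]
    refine ⟨h1, ?_⟩
    have : (n : ℝ) ≤ k := by exact_mod_cast hnk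
    gcongr

lemma Hn_le_Hb (n : ℕ) (y : ℝ) : Hn n y ≤ Hb y := by
  unfold Hb
  split_ifs with h
  · exact ENNReal.ofReal_le_ofReal (hr_clamp_le h (Or.inl rfl))
  · exact le_top

lemma Hb_eq_iSup (y : ℝ) : Hb y = ⨆ n, Hn n y := by
  apply le_antisymm _ (iSup_le fun n => Hn_le_Hb n y)
  unfold Hb
  split_ifs with h
  · obtain ⟨n, hn⟩ := exists_nat_one_div_lt (show (0 : ℝ) < 1 + y by linarith)
    refine le_iSup_of_le n ?_
    rw [Hn, clampN, max_eq_left (by linarith)]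
  · push Not at h
    rw [top_le_iff, iSup_eq_top]
    intro b hb
    have ht : Tendsto (fun n : ℕ => Real.log ((n : ℝ) + 1)) atTop atTop :=
      Real.tendsto_log_atTop.comp (tendsto_atTop_add_const_right _ _ tendsto_natCast_atTop_atTop)
    obtain ⟨n, hn⟩ := (ht.eventually_gt_atTop (b.toReal + 1)).exists
    refine ⟨n, ?_⟩
    have hp : (0 : ℝ) < 1 / ((n : ℝ) + 1) := by positivity
    rw [Hn, clampN, max_eq_right (by linarith), ENNReal.lt_ofReal_iff_toReal_lt hb.ne, hr]
    have : Real.log (1 + (-1 + 1 / ((n : ℝ) + 1))) = - Real.log ((n : ℝ) + 1) := by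
      rw [show 1 + (-1 + 1 / ((n : ℝ) + 1)) = ((n : ℝ) + 1)⁻¹ by rw [one_div]; ring, Real.log_inv]
    rw [this]; linarith

lemma Hn_cont (n : ℕ) : Continuous (Hn n) := by
  have h1 : Continuous (clampN n) := continuous_id.max continuous_const
  refine ENNReal.continuous_ofReal.comp ?_
  unfold hr
  refine h1.sub (Continuous.log (continuous_const.add h1) fun y => ?_)
  have := clampN_gt n y
  linarith

lemma Hb_meas : Measurable Hb := by
  have : Hb = fun y => ⨆ n, Hn n y := funext Hb_eq_iSup
  rw [this]
  exact Measurable.iSup fun n => (Hn_cont n).measurable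

lemma hr_clamp_bd (n : ℕ) (y : ℝ) : hr (clampN n y) ≤ ((n : ℝ) + 1) * min |y| (y ^ 2) := by
  set z := clampN n y with hz
  have hn : (0 : ℝ) < (n : ℝ) + 1 := by positivity
  have hz1 : -1 + 1 / ((n : ℝ) + 1) ≤ z := le_max_right _ _
  have hzy : |z| ≤ |y| := by
    rcases le_total (-1 + 1 / ((n : ℝ) + 1)) y with h1 | h1
    · rw [hz, clampN, max_eq_left h1]
    · rw [hz, clampN, max_eq_right h1]
      have := one_div_le_one_nat n
      rw [abs_of_nonpos (by linarith), abs_of_nonpos (by linarith)]; linarith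
  have h0 : 0 < 1 + z := by linarith [clampN_gt n y]
  have h1 : 1 ≤ ((n : ℝ) + 1) * (1 + z) := by
    have : 1 / ((n : ℝ) + 1) ≤ 1 + z := by linarith
    rw [div_le_iff₀ hn] at this; linarith
  have h2 : hr z ≤ z ^ 2 / (1 + z) := by
    have := Real.one_sub_inv_le_log_of_pos h0
    unfold hr
    have e : z ^ 2 / (1 + z) = z - (1 - (1 + z)⁻¹) := by field_simp; ring
    linarith
  have h3 : z ^ 2 / (1 + z) ≤ ((n : ℝ) + 1) * z ^ 2 := by
    rw [div_le_iff₀ h0]; nlinarith [sq_nonneg z]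
  have h4 : z ^ 2 / (1 + z) ≤ ((n : ℝ) + 1) * |z| := by
    rw [div_le_iff₀ h0, ← sq_abs, sq]
    have : |z| ≤ ((n : ℝ) + 1) * (1 + z) := by
      rcases le_total 0 z with h | h
      · rw [abs_of_nonneg h]; nlinarith [(Nat.cast_nonneg n : (0 : ℝ) ≤ n)]
      · rw [abs_of_nonpos h]; linarith
    nlinarith [abs_nonneg z]
  rw [mul_min_of_nonneg _ _ hn.le]
  refine le_min ?_ ?_
  · nlinarith
  · have : z ^ 2 ≤ y ^ 2 := sq_le_sq.2 hzy
    nlinarith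

lemma Hb_smul {t : ℝ} (h0 : 0 ≤ t) (h1 : t ≤ 1) (y : ℝ) (ht : 0 < t) :
    Hb (t * y) ≤ ENNReal.ofReal t * Hb y := by
  by_cases hy : -1 < y
  · have hty : -1 < t * y := by nlinarith
    simp only [Hb, hy, hty, if_true]
    rw [← ENNReal.ofReal_mul h0]
    apply ENNReal.ofReal_le_ofReal
    have h2 : (0 : ℝ) < 1 + y := by linarith
    have h3 := Real.log_le_log (by positivity) (rpow_one_add_le_one_add_mul_self hy.le h0 h1)
    rw [Real.log_rpow h2] at h3
    unfold hr; linarith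
  · simp only [Hb, hy, if_false]
    rw [ENNReal.mul_top (by simpa using ht)]
    exact le_top

lemma Hb_lim {y : ℝ} (hy : 0 ≤ y) :
    Tendsto (fun n : ℕ => ENNReal.ofReal (1 / ((n : ℝ) + 1)) * Hb (((n : ℝ) + 1) * y)) atTop
      (nhds (ENNReal.ofReal y)) := by
  have e : ∀ n : ℕ, ENNReal.ofReal (1 / ((n : ℝ) + 1)) * Hb (((n : ℝ) + 1) * y)
      = ENNReal.ofReal (y - Real.log (1 + ((n : ℝ) + 1) * y) / ((n : ℝ) + 1)) := by
    intro n
    have hn : (0 : ℝ) < (n : ℝ) + 1 := by positivity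
    have : -1 < ((n : ℝ) + 1) * y := by nlinarith [mul_nonneg hn.le hy]
    simp only [Hb, this, if_true]
    rw [← ENNReal.ofReal_mul (by positivity), hr]
    congr 1
    field_simp
  simp_rw [e]
  apply ENNReal.tendsto_ofReal
  have ht : Tendsto (fun n : ℕ => (n : ℝ) + 1) atTop atTop :=
    tendsto_atTop_add_const_right _ _ tendsto_natCast_atTop_atTop
  suffices h : Tendsto (fun n : ℕ => Real.log (1 + ((n : ℝ) + 1) * y) / ((n : ℝ) + 1)) atTop (nhds 0) by
    simpa using (tendsto_const_nhds (x := y)).sub h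
  rcases hy.eq_or_lt with rfl | hy
  · simp
  have hs : Tendsto (fun n : ℕ => 1 + ((n : ℝ) + 1) * y) atTop atTop :=
    tendsto_atTop_add_const_left _ _ (ht.atTop_mul_const hy)
  have h1 := (Real.isLittleO_log_id_atTop.tendsto_div_nhds_zero).comp hs
  have h2 : Tendsto (fun n : ℕ => 1 / ((n : ℝ) + 1) + y) atTop (nhds (0 + y)) :=
    tendsto_one_div_add_atTop_nhds_zero_nat.add tendsto_const_nhds
  have h3 := h1.mul h2
  rw [zero_mul] at h3
  refine h3.congr fun n => ?_
  have hn : (0 : ℝ) < (n : ℝ) + 1 := by positivity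
  have : (0 : ℝ) < 1 + ((n : ℝ) + 1) * y := by positivity
  simp only [Function.comp_apply, id]
  field_simp

def aR (b : Fin d → ℝ) (c : Matrix (Fin d) (Fin d) ℝ) (v : Fin d → ℝ) : ℝ :=
  v ⬝ᵥ b - (1 / 2) * (v ⬝ᵥ (c *ᵥ v))

def Jn (K : Measure (Fin d → ℝ)) (n : ℕ) (v : Fin d → ℝ) : ℝ≥0∞ := ∫⁻ x, Hn n (v ⬝ᵥ x) ∂K

def Jb (K : Measure (Fin d → ℝ)) (v : Fin d → ℝ) : ℝ≥0∞ := ∫⁻ x, Hb (v ⬝ᵥ x) ∂K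

def Pb (K : Measure (Fin d → ℝ)) (b : Fin d → ℝ) (c : Matrix (Fin d) (Fin d) ℝ)
    (v : Fin d → ℝ) : EReal := ((aR b c v : ℝ) : EReal) - ((Jb K v : ℝ≥0∞) : EReal)

def Pn (K : Measure (Fin d → ℝ)) (b : Fin d → ℝ) (c : Matrix (Fin d) (Fin d) ℝ) (n : ℕ)
    (v : Fin d → ℝ) : ℝ := aR b c v - (Jn K n v).toReal

lemma dot_cont (v : Fin d → ℝ) : Continuous fun x : Fin d → ℝ => v ⬝ᵥ x :=
  continuous_const.dotProduct continuous_id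

lemma dot_cont' (x : Fin d → ℝ) : Continuous fun v : Fin d → ℝ => v ⬝ᵥ x :=
  continuous_id.dotProduct continuous_const

lemma Jb_eq (K : Measure (Fin d → ℝ)) (v : Fin d → ℝ) : Jb K v = ⨆ n, Jn K n v := by
  have h := lintegral_iSup (μ := K) (f := fun n x => Hn n (v ⬝ᵥ x))
    (fun n => ((Hn_cont n).comp (dot_cont v)).measurable) (fun n k h x => Hn_mono _ h)
  unfold Jb Jn
  rw [← h]
  simp_rw [Hb_eq_iSup]

lemma eucNorm_cont : Continuous (eucNorm (d := d)) :=
  (continuous_id.dotProduct continuous_id).sqrt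

lemma abs_dot_le (v x : Fin d → ℝ) : |v ⬝ᵥ x| ≤ eucNorm v * eucNorm x := by
  unfold eucNorm
  rw [← Real.sqrt_mul (by simpa using dotProduct_self_star_nonneg v)]
  apply Real.abs_le_sqrt
  have := Finset.sum_mul_sq_le_sq_mul_sq Finset.univ v x
  simpa [dotProduct, sq] using this

lemma Hn_dot_bd (n : ℕ) {L : ℝ} (v x : Fin d → ℝ) (hL : eucNorm v ≤ L) :
    Hn n (v ⬝ᵥ x) ≤ ENNReal.ofReal (((n : ℝ) + 1) * (1 + L) ^ 2) *
      ENNReal.ofReal (min (eucNorm x) (eucNorm x ^ 2)) := by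
  have h0 : 0 ≤ eucNorm v := Real.sqrt_nonneg _
  have hx : 0 ≤ eucNorm x := Real.sqrt_nonneg _
  rw [← ENNReal.ofReal_mul (by positivity)]
  apply ENNReal.ofReal_le_ofReal
  refine (hr_clamp_bd n _).trans ?_
  rw [mul_assoc]
  gcongr
  have h1 := abs_dot_le v x
  have h2 : |v ⬝ᵥ x| ≤ L * eucNorm x := h1.trans (by gcongr)
  have h3 : (v ⬝ᵥ x) ^ 2 ≤ (L * eucNorm x) ^ 2 := by
    rw [← sq_abs]; gcongr
  have hL0 : 0 ≤ L := h0.trans hL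
  rw [mul_min_of_nonneg _ _ (by positivity)]
  refine min_le_min ?_ ?_
  · refine h2.trans ?_
    gcongr; nlinarith
  · refine h3.trans ?_
    rw [mul_pow]
    gcongr; linarith

lemma bound_fin {K : Measure (Fin d → ℝ)} (hK : LevyIntegrable K) (C : ℝ) :
    ∫⁻ x, ENNReal.ofReal C * ENNReal.ofReal (min (eucNorm x) (eucNorm x ^ 2)) ∂K ≠ ⊤ := by
  rw [lintegral_const_mul' _ _ ENNReal.ofReal_ne_top]
  exact ENNReal.mul_ne_top ENNReal.ofReal_ne_top hK

lemma Jn_fin {K : Measure (Fin d → ℝ)} (hK : LevyIntegrable K) (n : ℕ) (v : Fin d → ℝ) :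
    Jn K n v ≠ ⊤ :=
  ne_top_of_le_ne_top (bound_fin hK _) (lintegral_mono fun x => Hn_dot_bd n v x le_rfl)

lemma Jn_cont {K : Measure (Fin d → ℝ)} (hK : LevyIntegrable K) (n : ℕ) :
    Continuous (Jn K n) := by
  rw [continuous_iff_continuousAt]
  intro v0
  refine tendsto_lintegral_filter_of_dominated_convergence
    (fun x => ENNReal.ofReal (((n : ℝ) + 1) * (1 + (eucNorm v0 + 1)) ^ 2) *
      ENNReal.ofReal (min (eucNorm x) (eucNorm x ^ 2))) ?_ ?_ (bound_fin hK _) ?_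
  · exact Eventually.of_forall fun v => ((Hn_cont n).comp (dot_cont v)).measurable
  · have : ∀ᶠ v in nhds v0, eucNorm v < eucNorm v0 + 1 :=
      eucNorm_cont.continuousAt.eventually_lt_const (by linarith)
    filter_upwards [this] with v hv
    exact Eventually.of_forall fun x => Hn_dot_bd n v x hv.le
  · exact Eventually.of_forall fun x => ((Hn_cont n).comp (dot_cont' x)).continuousAt

lemma aR_cont (b : Fin d → ℝ) (c : Matrix (Fin d) (Fin d) ℝ) : Continuous (aR b c) := by
  unfold aR
  exact (dot_cont' b).sub (continuous_const.mul
    (continuous_id.dotProduct (continuous_const.matrix_mulVec continuous_id)))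

lemma Pn_cont {K : Measure (Fin d → ℝ)} (hK : LevyIntegrable K) (b : Fin d → ℝ)
    (c : Matrix (Fin d) (Fin d) ℝ) (n : ℕ) : Continuous (Pn K b c n) := by
  refine (aR_cont b c).sub ?_
  exact ENNReal.continuousOn_toReal.comp_continuous (Jn_cont hK n) fun v => Jn_fin hK n v

lemma le_sub_iff_aux (r a : ℝ) (x : ℝ≥0∞) :
    (r : EReal) ≤ (a : EReal) - (x : EReal) ↔ r ≤ a ∧ x ≤ ENNReal.ofReal (a - r) := by
  induction x with
  | top => simp
  | coe x =>
    have : ((x : ℝ≥0∞) : EReal) = ((x : ℝ) : EReal) := rfl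
    rw [this, ← EReal.coe_sub, EReal.coe_le_coe_iff]
    have h0 := x.2
    constructor
    · intro h
      have h1 : r ≤ a := by linarith [show (0 : ℝ) ≤ x from h0]
      refine ⟨h1, ?_⟩
      rw [← ENNReal.ofReal_coe_nnreal]
      exact ENNReal.ofReal_le_ofReal (by linarith)
    · rintro ⟨h1, h2⟩
      rw [← ENNReal.ofReal_coe_nnreal, ENNReal.ofReal_le_ofReal_iff (by linarith)] at h2
      linarith

lemma Pb_ne_top {K : Measure (Fin d → ℝ)} (b : Fin d → ℝ)
    (c : Matrix (Fin d) (Fin d) ℝ) (v : Fin d → ℝ) : Pb K b c v ≠ ⊤ := by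
  unfold Pb
  induction Jb K v with
  | top => simp
  | coe x =>
    have : ((x : ℝ≥0∞) : EReal) = ((x : ℝ) : EReal) := rfl
    rw [this, ← EReal.coe_sub]
    exact EReal.coe_ne_top _

lemma le_Pb_iff {K : Measure (Fin d → ℝ)} (hK : LevyIntegrable K) (b : Fin d → ℝ)
    (c : Matrix (Fin d) (Fin d) ℝ) (r : EReal) (v : Fin d → ℝ) :
    r ≤ Pb K b c v ↔ ∀ n, r ≤ (Pn K b c n v : EReal) := by
  have e : ∀ n, (Pn K b c n v : EReal) = ((aR b c v : ℝ) : EReal) - ((Jn K n v : ℝ≥0∞) : EReal) := by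
    intro n
    rw [Pn, EReal.coe_sub, EReal.coe_ennreal_toReal (Jn_fin hK n v)]
  simp_rw [e]
  unfold Pb
  rw [Jb_eq]
  induction r with
  | bot => simp
  | top =>
    constructor
    · intro h
      have := Pb_ne_top (K := K) b c v
      unfold Pb at this
      rw [Jb_eq] at this
      exact absurd (top_le_iff.1 h) this
    · intro h
      have := h 0
      rw [← e 0] at this
      exact absurd (top_le_iff.1 this) (EReal.coe_ne_top _)
  | coe r =>
    simp_rw [le_sub_iff_aux, iSup_le_iff]
    exact ⟨fun h n => ⟨h.1, h.2 n⟩, fun h => ⟨(h 0).1, fun n => (h n).2⟩⟩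

lemma Pn_anti {K : Measure (Fin d → ℝ)} (hK : LevyIntegrable K) (b : Fin d → ℝ)
    (c : Matrix (Fin d) (Fin d) ℝ) (v : Fin d → ℝ) : Antitone fun n => Pn K b c n v := by
  intro n k h
  have : (Jn K n v).toReal ≤ (Jn K k v).toReal :=
    ENNReal.toReal_mono (Jn_fin hK k v) (lintegral_mono fun x => Hn_mono _ h)
  simp only [Pn]; linarith

lemma Psi_eq {K : Measure (Fin d → ℝ)} (b : Fin d → ℝ)
    (c : Matrix (Fin d) (Fin d) ℝ) {v : Fin d → ℝ} (hv : v ∈ Dset K) :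
    Psi K b c v = Pb K b c v := by
  unfold Psi Pb Jb aR
  congr 2
  refine lintegral_congr_ae ?_
  filter_upwards [hv] with x hx
  simp [Hb, hx, hr]

lemma mem_D {K : Measure (Fin d → ℝ)} {v : Fin d → ℝ} (hv : Jb K v ≠ ⊤) : v ∈ Dset K := by
  have := ae_lt_top (Hb_meas.comp (dot_cont v).measurable) hv
  filter_upwards [this] with x hx
  by_contra h
  simp [Hb, h] at hx

lemma Pb_bot {K : Measure (Fin d → ℝ)} (b : Fin d → ℝ)
    (c : Matrix (Fin d) (Fin d) ℝ) {v : Fin d → ℝ} (hv : v ∉ Dset K) : Pb K b c v = ⊥ := by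
  have : Jb K v = ⊤ := by
    by_contra h
    exact hv (mem_D h)
  simp [Pb, this]

lemma sSup_eq (K : Measure (Fin d → ℝ)) (b : Fin d → ℝ)
    (c : Matrix (Fin d) (Fin d) ℝ) : sSup (Psi K b c '' Dset K) = ⨆ v, Pb K b c v := by
  apply le_antisymm
  · apply sSup_le
    rintro _ ⟨v, hv, rfl⟩
    rw [Psi_eq b c hv]
    exact le_iSup _ v
  · apply iSup_le
    intro v
    by_cases hv : v ∈ Dset K
    · rw [← Psi_eq b c hv]
      exact le_sSup ⟨v, hv, rfl⟩
    · rw [Pb_bot b c hv]; exact bot_le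

lemma nonneg_Pb_iff (K : Measure (Fin d → ℝ)) (b : Fin d → ℝ)
    (c : Matrix (Fin d) (Fin d) ℝ) (v : Fin d → ℝ) :
    0 ≤ Pb K b c v ↔ 0 ≤ aR b c v ∧ Jb K v ≤ ENNReal.ofReal (aR b c v) := by
  have := le_sub_iff_aux 0 (aR b c v) (Jb K v)
  rw [sub_zero] at this
  exact this

lemma Pb_closed {K : Measure (Fin d → ℝ)} (hK : LevyIntegrable K) (b : Fin d → ℝ)
    (c : Matrix (Fin d) (Fin d) ℝ) (r : EReal) : IsClosed {v | r ≤ Pb K b c v} := by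
  have : {v | r ≤ Pb K b c v} = ⋂ n, {v | r ≤ (Pn K b c n v : EReal)} := by
    ext v; simp [le_Pb_iff hK]
  rw [this]
  exact isClosed_iInter fun n => isClosed_le continuous_const
    (continuous_coe_real_ereal.comp (Pn_cont hK b c n))

lemma Pb_zero (K : Measure (Fin d → ℝ)) (b : Fin d → ℝ)
    (c : Matrix (Fin d) (Fin d) ℝ) : 0 ≤ Pb K b c 0 := by
  rw [nonneg_Pb_iff]
  simp [aR, Jb, Hb, hr]

lemma Pb_smul (K : Measure (Fin d → ℝ)) (b : Fin d → ℝ)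
    {c : Matrix (Fin d) (Fin d) ℝ} (hc : c.PosSemidef) {v : Fin d → ℝ} (hv : 0 ≤ Pb K b c v)
    {t : ℝ} (h0 : 0 ≤ t) (h1 : t ≤ 1) : 0 ≤ Pb K b c (t • v) := by
  rcases h0.eq_or_lt with rfl | ht
  · rw [zero_smul]; exact Pb_zero K b c
  rw [nonneg_Pb_iff] at hv ⊢
  have hq : 0 ≤ v ⬝ᵥ (c *ᵥ v) := by simpa using hc.dotProduct_mulVec_nonneg v
  have ha : t * aR b c v ≤ aR b c (t • v) := by
    simp only [aR, mulVec_smul, smul_dotProduct, dotProduct_smul, smul_eq_mul]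
    have : t * (t * (v ⬝ᵥ (c *ᵥ v))) ≤ t * (v ⬝ᵥ (c *ᵥ v)) := by
      have : t * (v ⬝ᵥ (c *ᵥ v)) ≤ (v ⬝ᵥ (c *ᵥ v)) := by nlinarith
      nlinarith
    linarith
  refine ⟨(mul_nonneg h0 hv.1).trans ha, ?_⟩
  calc Jb K (t • v) ≤ ∫⁻ x, ENNReal.ofReal t * Hb (v ⬝ᵥ x) ∂K := by
        refine lintegral_mono fun x => ?_
        rw [smul_dotProduct, smul_eq_mul]
        exact Hb_smul h0 h1 _ ht
    _ = ENNReal.ofReal t * Jb K v := lintegral_const_mul' _ _ ENNReal.ofReal_ne_top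
    _ ≤ ENNReal.ofReal t * ENNReal.ofReal (aR b c v) := by gcongr; exact hv.2
    _ = ENNReal.ofReal (t * aR b c v) := (ENNReal.ofReal_mul h0).symm
    _ ≤ _ := ENNReal.ofReal_le_ofReal ha

lemma recession (K : Measure (Fin d → ℝ)) (b : Fin d → ℝ)
    {c : Matrix (Fin d) (Fin d) ℝ} (hc : c.PosSemidef) {u : Fin d → ℝ}
    (hu : ∀ t : ℝ, 0 ≤ t → 0 ≤ Pb K b c (t • u)) (hI : Iset K b c = ∅) : u ∈ Nset K b c := by
  by_contra hN
  have h1 : ∀ n : ℕ, ∀ᵐ x ∂K, -1 < (n : ℝ) * (u ⬝ᵥ x) := by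
    intro n
    have h := (nonneg_Pb_iff K b c _).1 (hu n (Nat.cast_nonneg n))
    have := mem_D (ne_top_of_le_ne_top ENNReal.ofReal_ne_top h.2)
    filter_upwards [this] with x hx
    rwa [smul_dotProduct, smul_eq_mul] at hx
  have h2 : ∀ᵐ x ∂K, ¬ (u ⬝ᵥ x < 0) := by
    filter_upwards [ae_all_iff.2 h1] with x hx hneg
    obtain ⟨n, hn⟩ := exists_nat_gt (1 / (-(u ⬝ᵥ x)))
    rw [div_lt_iff₀ (by linarith)] at hn
    linarith [hx n]
  have hmem : u ∈ Iset K b c := by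
    refine ⟨⟨?_, ?_⟩, hN⟩
    · simpa [ae_iff] using h2
    · have hA : ∀ t : ℝ, 0 ≤ t → 0 ≤ t * (u ⬝ᵥ b) - 1 / 2 * (t * (t * (u ⬝ᵥ (c *ᵥ u)))) := by
        intro t ht
        have h := ((nonneg_Pb_iff K b c _).1 (hu t ht)).1
        simpa only [aR, mulVec_smul, smul_dotProduct, dotProduct_smul, smul_eq_mul] using h
      have hq : 0 ≤ u ⬝ᵥ (c *ᵥ u) := by simpa using hc.dotProduct_mulVec_nonneg u
      have hq0 : u ⬝ᵥ (c *ᵥ u) = 0 := by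
        by_contra hne
        have hpos : 0 < u ⬝ᵥ (c *ᵥ u) := lt_of_le_of_ne hq (Ne.symm hne)
        set Q := u ⬝ᵥ (c *ᵥ u)
        set B := u ⬝ᵥ b
        have h1 := hA (2 * (|B| + 1) / Q) (by positivity)
        have h2 : 2 * (|B| + 1) / Q * Q = 2 * (|B| + 1) := by field_simp
        have h3 : 0 < 2 * (|B| + 1) / Q := by positivity
        rw [h2] at h1
        have h4 := le_abs_self B
        nlinarith
      refine ⟨(hc.dotProduct_mulVec_zero_iff u).1 (by simpa using hq0), ?_⟩
      have hb0 : ∀ n : ℕ, ENNReal.ofReal (1 / ((n : ℝ) + 1)) * Jb K (((n : ℝ) + 1) • u)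
          ≤ ENNReal.ofReal (u ⬝ᵥ b) := by
        intro n
        have h := ((nonneg_Pb_iff K b c _).1 (hu ((n : ℝ) + 1) (by positivity))).2
        have e : aR b c (((n : ℝ) + 1) • u) = ((n : ℝ) + 1) * (u ⬝ᵥ b) := by
          simp only [aR, mulVec_smul, smul_dotProduct, dotProduct_smul, smul_eq_mul, hq0]
          ring
        rw [e] at h
        calc _ ≤ ENNReal.ofReal (1 / ((n : ℝ) + 1)) * ENNReal.ofReal (((n : ℝ) + 1) * (u ⬝ᵥ b)) := by
              gcongr
          _ = _ := by
              rw [← ENNReal.ofReal_mul (by positivity)]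
              congr 1
              field_simp
      calc ∫⁻ x, ENNReal.ofReal (u ⬝ᵥ x) ∂K
          = ∫⁻ x, liminf (fun n : ℕ => ENNReal.ofReal (1 / ((n : ℝ) + 1)) *
              Hb (((n : ℝ) + 1) * (u ⬝ᵥ x))) atTop ∂K := by
            refine lintegral_congr_ae ?_
            filter_upwards [h2] with x hx
            exact (Hb_lim (not_lt.1 hx)).liminf_eq.symm
        _ ≤ liminf (fun n : ℕ => ∫⁻ x, ENNReal.ofReal (1 / ((n : ℝ) + 1)) *
              Hb (((n : ℝ) + 1) * (u ⬝ᵥ x)) ∂K) atTop := by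
            refine lintegral_liminf_le fun n => ?_
            exact (Hb_meas.comp ((dot_cont u).measurable.const_mul _)).const_mul _
        _ ≤ ENNReal.ofReal (u ⬝ᵥ b) := by
            refine liminf_le_of_le (by isBoundedDefault) fun y hy => ?_
            obtain ⟨n, hn⟩ := hy.exists
            refine hn.trans (le_trans (le_of_eq ?_) (hb0 n))
            rw [lintegral_const_mul' _ _ ENNReal.ofReal_ne_top]
            simp only [Jb, smul_dotProduct, smul_eq_mul]
  rw [hI] at hmem
  exact hmem

def Nsub (K : Measure (Fin d → ℝ)) (b : Fin d → ℝ)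
    (c : Matrix (Fin d) (Fin d) ℝ) : Submodule ℝ (Fin d → ℝ) where
  carrier := Nset K b c
  zero_mem' := by simp [Nset]
  add_mem' := by
    rintro u v ⟨h1, h2, h3⟩ ⟨k1, k2, k3⟩
    refine ⟨?_, by rw [mulVec_add, h2, k2, add_zero], by rw [add_dotProduct, h3, k3, add_zero]⟩
    refine measure_mono_null (fun x hx => ?_) (measure_union_null h1 k1)
    by_contra h
    simp only [mem_union, mem_ofPred_eq, not_or, not_not] at h
    apply hx
    rw [add_dotProduct, h.1, h.2, add_zero]
  smul_mem' := by
    rintro t v ⟨k1, k2, k3⟩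
    refine ⟨?_, by rw [mulVec_smul, k2, smul_zero], by rw [smul_dotProduct, k3, smul_zero]⟩
    refine measure_mono_null (fun x hx => ?_) k1
    intro h
    apply hx
    rw [smul_dotProduct, h, smul_zero]

lemma Pb_add_N (K : Measure (Fin d → ℝ)) (b : Fin d → ℝ)
    {c : Matrix (Fin d) (Fin d) ℝ} (hc : c.PosSemidef) {u : Fin d → ℝ} (hu : u ∈ Nset K b c)
    (v : Fin d → ℝ) : Pb K b c (u + v) = Pb K b c v := by
  obtain ⟨h1, h2, h3⟩ := hu
  have ha : aR b c (u + v) = aR b c v := by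
    have : u ⬝ᵥ (c *ᵥ v) = 0 := by
      have hct : cᵀ = c := by simpa using hc.isHermitian.eq
      rw [dotProduct_mulVec, ← mulVec_transpose, hct, h2, zero_dotProduct]
    simp only [aR, mulVec_add, h2, add_dotProduct, h3, this, zero_add]
  have hJ : Jb K (u + v) = Jb K v := by
    refine lintegral_congr_ae ?_
    have : ∀ᵐ x ∂K, u ⬝ᵥ x = 0 := h1
    filter_upwards [this] with x hx
    rw [add_dotProduct, hx, zero_add]
  rw [Pb, ha, hJ, Pb]

lemma exists_max {K : Measure (Fin d → ℝ)} (hK : LevyIntegrable K) (b : Fin d → ℝ)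
    {c : Matrix (Fin d) (Fin d) ℝ} (hc : c.PosSemidef) (hI : Iset K b c = ∅) :
    ∃ w, ∀ v, Pb K b c v ≤ Pb K b c w := by
  obtain ⟨W, hW⟩ := Submodule.exists_isCompl (Nsub K b c)
  set S : Set (Fin d → ℝ) := {v | 0 ≤ Pb K b c v} ∩ W with hS
  have hcl : IsClosed S := (Pb_closed hK b c 0).inter W.closed_of_finiteDimensional
  have hst : StarConvex ℝ 0 S := by
    rw [starConvex_zero_iff]
    intro v hv t h0 h1
    exact ⟨Pb_smul K b hc hv.1 h0 h1, W.smul_mem t hv.2⟩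
  have hbd : Bornology.IsBounded S := by
    by_contra hb
    obtain ⟨u, hu0, hu⟩ := not_bounded_iff_exists_ne_zero_mem_asymptoticCone.1 hb
    have hray : ∀ t : ℝ, 0 ≤ t → t • u ∈ S := by
      intro t ht
      simpa using hst.smul_vadd_mem_of_isClosed_of_mem_asymptoticCone hcl ht hu
    have huN := recession K b hc (fun t ht => (hray t ht).1) hI
    have huW : u ∈ W := by simpa using (hray 1 zero_le_one).2
    exact hu0 (Submodule.disjoint_def.1 hW.disjoint u huN huW)
  have hcomp : IsCompact S := Metric.isCompact_of_isClosed_isBounded hcl hbd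
  have husc : UpperSemicontinuousOn (Pb K b c) S :=
    (upperSemicontinuous_iff_isClosed_preimage.2 fun r => Pb_closed hK b c r).upperSemicontinuousOn S
  obtain ⟨w, hw, hmax⟩ := UpperSemicontinuousOn.exists_isMaxOn
    (show S.Nonempty from ⟨0, Pb_zero K b c, W.zero_mem⟩) hcomp husc
  refine ⟨w, fun v => ?_⟩
  by_cases hv : 0 ≤ Pb K b c v
  · obtain ⟨u, hu, z, hz, rfl⟩ := Submodule.mem_sup.1 (hW.sup_eq_top ▸ Submodule.mem_top : v ∈ _ ⊔ _)
    rw [Pb_add_N K b hc hu] at hv ⊢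
    exact hmax ⟨hv, hz⟩
  · exact (not_le.1 hv).le.trans hw.1

def phiC (K : Measure (Fin d → ℝ)) (b : Fin d → ℝ) (c : Matrix (Fin d) (Fin d) ℝ)
    (q : Fin d → ℝ) (r : ℝ) : EReal :=
  ⨅ n : ℕ, ⨆ k : ℕ, ⨆ _ : TopologicalSpace.denseSeq (Fin d → ℝ) k ∈ Metric.closedBall q r,
    (Pn K b c n (TopologicalSpace.denseSeq (Fin d → ℝ) k) : EReal)

lemma exists_iff_phiC {K : Measure (Fin d → ℝ)} (hK : LevyIntegrable K) (b : Fin d → ℝ)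
    (c : Matrix (Fin d) (Fin d) ℝ) (q : Fin d → ℝ) {r : ℝ} (hr : 0 < r) (s : EReal) :
    (∃ v ∈ Metric.closedBall q r, s ≤ Pb K b c v) ↔ s ≤ phiC K b c q r := by
  have hcont : ∀ n, Continuous fun v => (Pn K b c n v : EReal) := fun n =>
    continuous_coe_real_ereal.comp (Pn_cont hK b c n)
  constructor
  · rintro ⟨v, hv, hs⟩
    refine le_iInf fun n => ?_
    refine ((le_Pb_iff hK b c s v).1 hs n).trans ?_
    set T := ⨆ k : ℕ, ⨆ _ : TopologicalSpace.denseSeq (Fin d → ℝ) k ∈ Metric.closedBall q r,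
      (Pn K b c n (TopologicalSpace.denseSeq (Fin d → ℝ) k) : EReal) with hT
    have hcl : IsClosed {v | (Pn K b c n v : EReal) ≤ T} := isClosed_le (hcont n) continuous_const
    have h1 : Metric.ball q r ∩ range (TopologicalSpace.denseSeq (Fin d → ℝ)) ⊆
        {v | (Pn K b c n v : EReal) ≤ T} := by
      rintro _ ⟨hb, k, rfl⟩
      have hm : TopologicalSpace.denseSeq (Fin d → ℝ) k ∈ Metric.closedBall q r :=
        Metric.ball_subset_closedBall hb
      rw [mem_ofPred_eq, hT]
      exact le_iSup_of_le k (le_iSup_of_le hm le_rfl)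
    have h2 := (TopologicalSpace.denseRange_denseSeq (Fin d → ℝ)).open_subset_closure_inter
      (Metric.isOpen_ball (x := q) (ε := r))
    have h3 : Metric.closedBall q r ⊆ {v | (Pn K b c n v : EReal) ≤ T} := by
      rw [← closure_ball q hr.ne']
      refine closure_minimal ?_ hcl
      exact h2.trans (closure_minimal h1 hcl)
    exact h3 hv
  · intro hs
    have hcomp : IsCompact (Metric.closedBall q r) := isCompact_closedBall q r
    have hcl : ∀ n, IsClosed (Metric.closedBall q r ∩ {v | s ≤ (Pn K b c n v : EReal)}) := fun n =>
      Metric.isClosed_closedBall.inter (isClosed_le continuous_const (hcont n))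
    have := IsCompact.nonempty_iInter_of_sequence_nonempty_isCompact_isClosed
      (fun n : ℕ => Metric.closedBall q r ∩ {v | s ≤ (Pn K b c n v : EReal)})
      (fun n v hv => ⟨hv.1, le_trans hv.2
        (EReal.coe_le_coe_iff.2 (Pn_anti hK b c v (Nat.le_succ n)))⟩)
      (fun n => ?_) (hcomp.of_isClosed_subset (hcl 0) inter_subset_left) hcl
    · obtain ⟨v, hv⟩ := this
      rw [mem_iInter] at hv
      exact ⟨v, (hv 0).1, (le_Pb_iff hK b c s v).2 fun n => (hv n).2⟩
    · obtain ⟨v, hv, hmax⟩ := hcomp.exists_isMaxOn ⟨q, Metric.mem_closedBall_self hr.le⟩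
        (hcont n).continuousOn
      refine ⟨v, hv, le_trans (hs.trans (iInf_le _ n)) ?_⟩
      exact iSup₂_le fun k hk => hmax hk

def psiM (K : Measure (Fin d → ℝ)) (b : Fin d → ℝ) (c : Matrix (Fin d) (Fin d) ℝ) : EReal :=
  ⨆ R : ℕ, phiC K b c 0 ((R : ℝ) + 1)

lemma psiM_eq {K : Measure (Fin d → ℝ)} (hK : LevyIntegrable K) (b : Fin d → ℝ)
    (c : Matrix (Fin d) (Fin d) ℝ) : psiM K b c = ⨆ v, Pb K b c v := by
  apply le_antisymm
  · refine iSup_le fun R => ?_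
    obtain ⟨v, -, hv⟩ := (exists_iff_phiC hK b c 0 (r := (R : ℝ) + 1) (by positivity) _).2 le_rfl
    exact hv.trans (le_iSup _ v)
  · refine iSup_le fun v => ?_
    obtain ⟨R, hR⟩ := exists_nat_ge ‖v‖
    refine le_iSup_of_le R ?_
    refine (exists_iff_phiC hK b c 0 (by positivity) _).1 ⟨v, ?_, le_rfl⟩
    rw [mem_closedBall_zero_iff]; linarith

lemma meas_phiC {E : Type*} [MeasurableSpace E] (K : ProbabilityTheory.Kernel E (Fin d → ℝ))
    {b : E → Fin d → ℝ} (hb : Measurable b)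
    {c : E → Matrix (Fin d) (Fin d) ℝ} (hc : ∀ i j, Measurable fun e => c e i j)
    (q : Fin d → ℝ) (r : ℝ) : Measurable fun e => phiC (K e) (b e) (c e) q r := by
  unfold phiC
  refine Measurable.iInf fun n => Measurable.iSup fun k => Measurable.iSup fun _ => ?_
  refine measurable_coe_real_ereal.comp ?_
  unfold Pn
  refine Measurable.sub ?_ (Measurable.ennreal_toReal ?_)
  · have hb' : ∀ i, Measurable fun e => b e i := fun i => (measurable_pi_apply i).comp hb
    simp only [aR, dotProduct, mulVec]
    fun_prop
  · exact Measurable.lintegral_kernel ((Hn_cont n).comp (dot_cont _)).measurable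

lemma selection {E X : Type*} [MeasurableSpace E] [MetricSpace X] [CompleteSpace X]
    [TopologicalSpace.SeparableSpace X] [MeasurableSpace X] [BorelSpace X] [Nonempty X]
    (M : E → Set X) (hcl : ∀ e, IsClosed (M e)) (hne : ∀ e, (M e).Nonempty)
    (hmeas : ∀ q : X, ∀ r : ℝ, 0 < r → MeasurableSet {e | ∃ v ∈ Metric.closedBall q r, v ∈ M e}) :
    ∃ g : E → X, Measurable g ∧ ∀ e, g e ∈ M e := by
  classical
  let ds := TopologicalSpace.denseSeq X
  have hds : ∀ p : X, ∀ r : ℝ, 0 < r → ∃ k, dist p (ds k) < r := fun p r hr =>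
    (TopologicalSpace.denseRange_denseSeq X).exists_dist_lt p hr
  let ρ : ℕ → ℝ := fun n => 1 / 2 / 2 ^ n
  have hρ : ∀ n, 0 < ρ n := fun n => by positivity
  have hρs : ∀ n, ρ (n + 1) = ρ n / 2 := fun n => by simp only [ρ, pow_succ]; field_simp
  let A : ℕ → X → Set E := fun n q => {e | ∃ v ∈ Metric.closedBall q (ρ n), v ∈ M e}
  have hA : ∀ n q, MeasurableSet (A n q) := fun n q => hmeas q _ (hρ n)
  -- one refinement step
  have step : ∀ n (f : E → X), Measurable f → (∀ e, e ∈ A n (f e)) →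
      ∃ f' : E → X, Measurable f' ∧ (∀ e, e ∈ A (n + 1) (f' e)) ∧
        ∀ e, dist (f e) (f' e) ≤ 2 * ρ n := by
    intro n f hf hfA
    let P : E → ℕ → Prop := fun e k => e ∈ A (n + 1) (ds k) ∧ dist (f e) (ds k) ≤ 2 * ρ n
    have hP : ∀ e, ∃ k, P e k := by
      intro e
      obtain ⟨v, hv, hvM⟩ := hfA e
      obtain ⟨k, hk⟩ := hds v _ (hρ (n + 1))
      refine ⟨k, ⟨v, hk.le, hvM⟩, ?_⟩
      have h1 := dist_triangle (f e) v (ds k)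
      have h2 : dist v (f e) ≤ ρ n := hv
      rw [dist_comm] at h2
      have := hρs n
      linarith [hρ n]
    have hfind : Measurable fun e => Nat.find (hP e) := by
      refine measurable_find hP fun k => ?_
      exact (hA _ _).inter (measurableSet_le (hf.dist measurable_const) measurable_const)
    refine ⟨fun e => ds (Nat.find (hP e)), (measurable_from_nat).comp hfind, ?_, ?_⟩
    · exact fun e => (Nat.find_spec (hP e)).1
    · exact fun e => (Nat.find_spec (hP e)).2
  have base : ∃ f : E → X, Measurable f ∧ ∀ e, e ∈ A 0 (f e) := by
    have hP : ∀ e, ∃ k, e ∈ A 0 (ds k) := by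
      intro e
      obtain ⟨v, hv⟩ := hne e
      obtain ⟨k, hk⟩ := hds v _ (hρ 0)
      exact ⟨k, v, hk.le, hv⟩
    refine ⟨fun e => ds (Nat.find (hP e)), (measurable_from_nat).comp
      (measurable_find hP fun k => hA _ _), fun e => Nat.find_spec (hP e)⟩
  choose! nx hnx1 hnx2 hnx3 using step
  obtain ⟨f0, hf0, hf0A⟩ := base
  let F : ℕ → E → X := fun n => Nat.rec f0 (fun n f => nx n f) n
  have hF : ∀ n, Measurable (F n) ∧ ∀ e, e ∈ A n (F n e) := by
    intro n
    induction n with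
    | zero => exact ⟨hf0, hf0A⟩
    | succ n ih => exact ⟨hnx1 n _ ih.1 ih.2, hnx2 n _ ih.1 ih.2⟩
  have hdist : ∀ n e, dist (F n e) (F (n + 1) e) ≤ 2 / 2 / 2 ^ n := by
    intro n e
    refine (hnx3 n _ (hF n).1 (hF n).2 e).trans (le_of_eq ?_)
    simp only [ρ]; ring
  have hc : ∀ e, CauchySeq fun n => F n e := fun e =>
    cauchySeq_of_le_geometric_two (fun n => hdist n e)
  choose g hg using fun e => cauchySeq_tendsto_of_complete (hc e)
  refine ⟨g, measurable_of_tendsto_metrizable (fun n => (hF n).1) (tendsto_pi_nhds.2 hg), ?_⟩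
  intro e
  choose v hv hvM using fun n => (hF n).2 e
  have hρ0 : Tendsto ρ atTop (nhds 0) := by
    have := (tendsto_pow_atTop_nhds_zero_of_lt_one (r := (1 / 2 : ℝ)) (by norm_num)
      (by norm_num)).const_mul (1 / 2)
    rw [mul_zero] at this
    refine this.congr fun n => ?_
    simp only [ρ, one_div, inv_pow]; rfl
  have hvt : Tendsto v atTop (nhds (g e)) := by
    refine (tendsto_iff_of_dist ?_).1 (hg e)
    refine squeeze_zero (fun _ => dist_nonneg) (fun n => ?_) hρ0
    rw [dist_comm]; exact hv n
  exact (hcl e).mem_of_tendsto hvt (Eventually.of_forall hvM)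

/-- Measurable-selection version of the maximisation result, with a parameter space
`(E, Σ, m)` (in the paper, `(Ω × [0,T], 𝒫, P(dω)dA_t(ω))`), a transition kernel `K` from
`E` to `ℝ^d`, and measurable coefficients `b`, `c`.  The value function
`ψ(e) = sup_{v ∈ D_e} Ψ_e(v)` is measurable for the `m`-completion of `Σ`
(i.e. null-measurable), and if `m(I ≠ ∅) = 0` then `ψ < ∞` `m`-a.e. and there is a
`Σ`-measurable selector `g` with `ψ(e) = Ψ_e(g(e))` for `m`-a.e. `e`. -/
theorem stmt_14 {E : Type*} [MeasurableSpace E] (m : Measure E) [SigmaFinite m]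
    (hd : 1 ≤ d) (K : ProbabilityTheory.Kernel E (Fin d → ℝ))
    (b : E → Fin d → ℝ) (hb : Measurable b)
    (c : E → Matrix (Fin d) (Fin d) ℝ) (hc : ∀ i j, Measurable fun e => c e i j)
    (hcpsd : ∀ e, (c e).PosSemidef)
    (hK : ∀ᵐ e ∂m, K e {0} = 0 ∧ LevyIntegrable (K e)) :
    NullMeasurable (fun e => sSup (Psi (K e) (b e) (c e) '' Dset (K e))) m ∧
    (m {e | Iset (K e) (b e) (c e) ≠ ∅} = 0 →
      (∀ᵐ e ∂m, sSup (Psi (K e) (b e) (c e) '' Dset (K e)) ≠ ⊤) ∧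
      ∃ g : E → Fin d → ℝ, Measurable g ∧
        ∀ᵐ e ∂m, sSup (Psi (K e) (b e) (c e) '' Dset (K e))
          = Psi (K e) (b e) (c e) (g e)) := by
  have hψ : ∀ᵐ e ∂m, sSup (Psi (K e) (b e) (c e) '' Dset (K e)) = psiM (K e) (b e) (c e) := by
    filter_upwards [hK] with e he
    rw [sSup_eq, psiM_eq he.2]
  have hpm : Measurable fun e => psiM (K e) (b e) (c e) :=
    Measurable.iSup fun R => meas_phiC K hb hc 0 _
  refine ⟨AEMeasurable.nullMeasurable ⟨_, hpm, hψ⟩, fun hI => ?_⟩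
  have hI' : ∀ᵐ e ∂m, Iset (K e) (b e) (c e) = ∅ := hI
  have hgood := hK.and hI'
  constructor
  · filter_upwards [hgood] with e he
    obtain ⟨w, hw⟩ := exists_max he.1.2 (b e) (hcpsd e) he.2
    rw [sSup_eq]
    exact ne_top_of_le_ne_top (Pb_ne_top (b e) (c e) w) (iSup_le hw)
  obtain ⟨N, hNsub, hNm, hN0⟩ := exists_measurable_superset_of_null (ae_iff.1 hgood)
  have hG : ∀ e, e ∉ N → LevyIntegrable (K e) ∧ Iset (K e) (b e) (c e) = ∅ := by
    intro e he
    by_contra h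
    exact he (hNsub fun h' => h ⟨h'.1.2, h'.2⟩)
  let M : E → Set (Fin d → ℝ) := fun e =>
    {v | e ∈ N ∨ psiM (K e) (b e) (c e) ≤ Pb (K e) (b e) (c e) v}
  have hs1 : ∀ e, IsClosed (M e) := by
    intro e
    by_cases he : e ∈ N
    · simp [M, he]
    · simpa [M, he] using Pb_closed (hG e he).1 (b e) (c e) _
  have hs2 : ∀ e, (M e).Nonempty := by
    intro e
    by_cases he : e ∈ N
    · exact ⟨0, Or.inl he⟩
    · obtain ⟨w, hw⟩ := exists_max (hG e he).1 (b e) (hcpsd e) (hG e he).2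
      refine ⟨w, Or.inr ?_⟩
      rw [psiM_eq (hG e he).1]
      exact iSup_le hw
  have hs3 : ∀ q : Fin d → ℝ, ∀ r : ℝ, 0 < r →
      MeasurableSet {e | ∃ v ∈ Metric.closedBall q r, v ∈ M e} := by
    intro q r hr
    have : {e | ∃ v ∈ Metric.closedBall q r, v ∈ M e} =
        N ∪ {e | psiM (K e) (b e) (c e) ≤ phiC (K e) (b e) (c e) q r} := by
      ext e
      by_cases he : e ∈ N
      · simp only [mem_union, he, true_or, iff_true]
        exact ⟨q, Metric.mem_closedBall_self hr.le, Or.inl he⟩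
      · simp only [mem_union, he, false_or]
        refine Iff.trans ?_ (exists_iff_phiC (hG e he).1 (b e) (c e) q hr _)
        simp [M, he]
    rw [this]
    exact hNm.union (measurableSet_le hpm (meas_phiC K hb hc q r))
  obtain ⟨g, hgm, hg⟩ := selection M hs1 hs2 hs3
  refine ⟨g, hgm, ?_⟩
  have hN : ∀ᵐ e ∂m, e ∉ N := by simpa [ae_iff] using hN0
  filter_upwards [hN] with e he
  have hL := (hG e he).1
  have hge : psiM (K e) (b e) (c e) ≤ Pb (K e) (b e) (c e) (g e) := (hg e).resolve_left he
  rw [psiM_eq hL] at hge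
  have heq := le_antisymm hge (le_iSup _ (g e))
  have hD : g e ∈ Dset (K e) := by
    by_contra hD
    rw [Pb_bot _ _ hD] at hge
    have := (Pb_zero (K e) (b e) (c e)).trans ((le_iSup _ 0).trans hge)
    simp at this
  rw [sSup_eq, heq, Psi_eq _ _ hD]
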